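/- Let p and q be nonnegative integers, let (x,u) ∈ L be in the monotone extended second order cone and let (y,v) ∈ M. Then ⟨x,y⟩ ≥ ‖u‖·∑_{i=1}^{p} yᵢ ≥ ‖u‖·‖v‖. -/

import Mathlib

open Finset RealInnerProductSpace

/-- The monotone extended second order cone (MESOC)
`L = {(x,u) ∈ ℝᵖ×ℝᵠ : x₁ ≥ x₂ ≥ ⋯ ≥ x_p ≥ ‖u‖}`. -/
def MESOC (p q : ℕ) : Set (EuclideanSpace ℝ (Fin p) × EuclideanSpace ℝ (Fin q)) :=
  {z | (∀ i j : Fin p, i ≤ j → z.1 j ≤ z.1 i) ∧ ∀ i : Fin p, ‖z.2‖ ≤ z.1 i}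

/-- The dual cone `M` of the MESOC, described explicitly. -/
def MESOCdual (p q : ℕ) : Set (EuclideanSpace ℝ (Fin p) × EuclideanSpace ℝ (Fin q)) :=
  {w | (∀ j : Fin p, (j : ℕ) + 1 < p → 0 ≤ ∑ i ∈ Finset.Iic j, w.1 i) ∧
    ‖w.2‖ ≤ ∑ i, w.1 i}

theorem abel_aux : ∀ (n : ℕ) (x y : Fin n → ℝ) (c : ℝ)
    (_ : ∀ i j : Fin n, i ≤ j → x j ≤ x i) (_ : ∀ i, c ≤ x i)
    (_ : ∀ k : ℕ, k ≤ n → 0 ≤ ∑ i : Fin n, if (i : ℕ) < k then y i else 0),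
    c * ∑ i, y i ≤ ∑ i, x i * y i := by
  intro n
  induction n with
  | zero => intros; simp
  | succ n ih =>
    intro x y c hx hc hy
    have h1 := ih (fun i => x i.castSucc) (fun i => y i.castSucc) (x (Fin.last n))
      (fun i j h => hx _ _ (by simpa using h)) (fun i => hx _ _ (Fin.le_last _))
      (fun k hk => by
        have := hy k (by omega)
        rw [Fin.sum_univ_castSucc] at this
        simpa [Nat.not_lt.mpr hk] using this)
    have h2 := hy (n + 1) le_rfl
    have h3 : (∑ i : Fin (n+1), if (i : ℕ) < n + 1 then y i else 0) = ∑ i, y i :=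
      Finset.sum_congr rfl (fun i _ => if_pos i.2)
    rw [h3] at h2
    have h4 := mul_le_mul_of_nonneg_right (hc (Fin.last n)) h2
    refine h4.trans ?_
    rw [Fin.sum_univ_castSucc, Fin.sum_univ_castSucc (f := fun i => x i * y i)]
    linarith

/-- For `(x,u) ∈ L` and `(y,v) ∈ M` one has `⟨x,y⟩ ≥ ‖u‖·∑ᵢ yᵢ ≥ ‖u‖·‖v‖`. -/
theorem mesoc_inner_ineq (p q : ℕ)
    (z w : EuclideanSpace ℝ (Fin p) × EuclideanSpace ℝ (Fin q))
    (hz : z ∈ MESOC p q) (hw : w ∈ MESOCdual p q) :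
    ‖z.2‖ * ∑ i, w.1 i ≤ ⟪z.1, w.1⟫ ∧ ‖z.2‖ * ‖w.2‖ ≤ ‖z.2‖ * ∑ i, w.1 i := by
  obtain ⟨hz1, hz2⟩ := hz
  obtain ⟨hw1, hw2⟩ := hw
  refine ⟨?_, mul_le_mul_of_nonneg_left hw2 (norm_nonneg _)⟩
  have key := abel_aux p (fun i => z.1 i) (fun i => w.1 i) ‖z.2‖ hz1 hz2 (by
    intro k hk
    rcases Nat.eq_zero_or_pos k with rfl | hk0
    · simp
    rcases hk.lt_or_eq with hlt | rfl
    · have h := hw1 ⟨k - 1, by omega⟩ (by simp only; omega)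
      rw [← Finset.sum_filter]
      convert h using 2
      ext i
      simp only [Finset.mem_filter, Finset.mem_univ, true_and, Finset.mem_Iic, Fin.le_def]
      omega
    · refine ((norm_nonneg _).trans hw2).trans (le_of_eq ?_)
      exact Finset.sum_congr rfl (fun i _ => (if_pos i.2).symm))
  refine key.trans (le_of_eq ?_)
  rw [PiLp.inner_apply]
  exact Finset.sum_congr rfl (fun i _ => by simp [mul_comm])
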